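/- arXiv:1205.3513 — 3 statements merged into one kernel-verified Lean document; each statement's English description precedes it below -/
import Mathlib

section
/- Let K(Z₀,Z₁,Z₂,Z₃) = (Z₁Z₂ − Z₀Z₃)² + 2Z₀Z₁(Z₁Z₂ + Z₀Z₃). For every (Z₀,Z₁,Z₂,Z₃) ∈ ℂ⁴, all four partial derivatives ∂K/∂Z₀, ∂K/∂Z₁, ∂K/∂Z₂, ∂K/∂Z₃ vanish at (Z₀,Z₁,Z₂,Z₃) if and only if (Z₀ = 0 and Z₂ = 0) or (Z₁ = 0 and Z₃ = 0) or (Z₀ = 0 and Z₁ = 0). Hence the singular locus of the quartic surface 𝒦 = {K = 0} ⊂ ℂP³ is exactly the union of the three lines m₀₂ = {Z₀ = Z₂ = 0}, m₁₃ = {Z₁ = Z₃ = 0} and m₀₁ = {Z₀ = Z₁ = 0}. -/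
open MvPolynomial

/-- The quartic `K = (Z₁Z₂ - Z₀Z₃)² + 2Z₀Z₁(Z₁Z₂ + Z₀Z₃)` as a polynomial in the four
variables `Z₀, Z₁, Z₂, Z₃`. -/
noncomputable def Kpoly : MvPolynomial (Fin 4) ℂ :=
  (X 1 * X 2 - X 0 * X 3) ^ 2 + 2 * X 0 * X 1 * (X 1 * X 2 + X 0 * X 3)

/-- The partial derivatives of `K`, evaluated at a point. -/
theorem eval_pderiv_Kpoly (Z : Fin 4 → ℂ) :
    eval Z (pderiv 0 Kpoly) =
        -2 * Z 3 * (Z 1 * Z 2 - Z 0 * Z 3) + 2 * Z 1 ^ 2 * Z 2 + 4 * Z 0 * Z 1 * Z 3 ∧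
      eval Z (pderiv 1 Kpoly) =
        2 * Z 2 * (Z 1 * Z 2 - Z 0 * Z 3) + 4 * Z 0 * Z 1 * Z 2 + 2 * Z 0 ^ 2 * Z 3 ∧
      eval Z (pderiv 2 Kpoly) = 2 * Z 1 * (Z 1 * Z 2 - Z 0 * Z 3 + Z 0 * Z 1) ∧
      eval Z (pderiv 3 Kpoly) = 2 * Z 0 * (Z 0 * Z 1 - (Z 1 * Z 2 - Z 0 * Z 3)) := by
  have h2 (i : Fin 4) : pderiv i (2 : MvPolynomial (Fin 4) ℂ) = 0 :=
    pderiv_C (a := (2 : ℂ))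
  refine ⟨?_, ?_, ?_, ?_⟩ <;>
  · simp [Kpoly, Derivation.leibniz, Derivation.leibniz_pow, pderiv_X, h2]
    ring

/-- All four partial derivatives of `K` vanish at `(Z₀,Z₁,Z₂,Z₃) ∈ ℂ⁴`
iff `Z₀ = Z₂ = 0`, or `Z₁ = Z₃ = 0`, or `Z₀ = Z₁ = 0`; hence the singular locus of the
quartic surface `𝒦 = {K = 0} ⊂ ℂP³` is the union of the lines `m₀₂ ∪ m₁₃ ∪ m₀₁`. -/
theorem statement16 (Z : Fin 4 → ℂ) :
    (∀ i : Fin 4, eval Z (pderiv i Kpoly) = 0) ↔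
      (Z 0 = 0 ∧ Z 2 = 0) ∨ (Z 1 = 0 ∧ Z 3 = 0) ∨ (Z 0 = 0 ∧ Z 1 = 0) := by
  obtain ⟨e0, e1, e2, e3⟩ := eval_pderiv_Kpoly Z
  simp only [Fin.forall_fin_succ, Fin.isValue, Fin.succ_zero_eq_one, Fin.succ_one_eq_two,
    IsEmpty.forall_iff, and_true, show Fin.succ (2 : Fin 3) = 3 from rfl, e0, e1, e2, e3]
  constructor
  · rintro ⟨-, -, h2, h3⟩
    by_cases ha : Z 0 = 0
    · by_cases hb : Z 1 = 0
      · exact Or.inr (Or.inr ⟨ha, hb⟩)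
      · exact Or.inl ⟨ha, by simpa [ha, hb] using h2⟩
    · by_cases hb : Z 1 = 0
      · exact Or.inr (Or.inl ⟨hb, by simpa [ha, hb] using h3⟩)
      · have h2' : Z 1 * Z 2 - Z 0 * Z 3 + Z 0 * Z 1 = 0 := by simpa [hb] using h2
        have h3' : Z 0 * Z 1 - (Z 1 * Z 2 - Z 0 * Z 3) = 0 := by simpa [ha] using h3
        have hab : Z 0 * Z 1 = 0 := by linear_combination (h2' + h3') / 2
        exact absurd hab (mul_ne_zero ha hb)
  · rintro (⟨h, h'⟩ | ⟨h, h'⟩ | ⟨h, h'⟩) <;> simp [h, h']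
end

section
/- Let p be a polynomial in four variables Z₀, Z₁, Z₂, Z₃ over ℂ, and suppose that p(Z₀, Z₁, (x²+ix)Z₀, (x²−ix)Z₁) = 0 for every x ∈ ℝ and all Z₀, Z₁ ∈ ℂ. Then p is divisible, in the polynomial ring ℂ[Z₀,Z₁,Z₂,Z₃], by the irreducible quartic K(Z₀,Z₁,Z₂,Z₃) = (Z₁Z₂ − Z₀Z₃)² + 2Z₀Z₁(Z₁Z₂ + Z₀Z₃). In particular, any algebraic surface in ℂP³ containing the twistor fibres over the parabola γ = {x²+ix : x ∈ ℝ} contains the quartic surface 𝒦 = {K = 0}. -/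
open MvPolynomial

/-- Inclusion of the indices of `Z₀, Z₁, Z₃` among those of `Z₀, Z₁, Z₂, Z₃`. -/
def skipTwo : Fin 3 → Fin 4 := ![0, 1, 3]

/-- Pseudo-division by `Kpoly`, viewed as a quadratic polynomial in `Z₂` with leading
coefficient `Z₁²`. -/
theorem exists_pseudo_division_Kpoly (p : MvPolynomial (Fin 4) ℂ) :
    ∃ (N : ℕ) (q : MvPolynomial (Fin 4) ℂ) (a b : MvPolynomial (Fin 3) ℂ),
      X 1 ^ N * p = Kpoly * q + rename skipTwo a + rename skipTwo b * X 2 := by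
  induction p using MvPolynomial.induction_on with
  | C c => exact ⟨0, 0, C c, 0, by simp⟩
  | add p₁ p₂ h₁ h₂ =>
    obtain ⟨N₁, q₁, a₁, b₁, h₁⟩ := h₁
    obtain ⟨N₂, q₂, a₂, b₂, h₂⟩ := h₂
    refine ⟨N₁ + N₂, X 1 ^ N₂ * q₁ + X 1 ^ N₁ * q₂, X 1 ^ N₂ * a₁ + X 1 ^ N₁ * a₂,
      X 1 ^ N₂ * b₁ + X 1 ^ N₁ * b₂, ?_⟩
    simp only [map_add, map_mul, map_pow, rename_X, show skipTwo 1 = 1 from rfl]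
    linear_combination X 1 ^ N₂ * h₁ + X 1 ^ N₁ * h₂
  | mul_X p i h =>
    obtain ⟨N, q, a, b, h⟩ := h
    have key : ∀ j : Fin 3, ∃ (N : ℕ) (q : MvPolynomial (Fin 4) ℂ) (a b : MvPolynomial (Fin 3) ℂ),
        X 1 ^ N * (p * X (skipTwo j)) =
          Kpoly * q + rename skipTwo a + rename skipTwo b * X 2 := fun j => by
      refine ⟨N, q * X (skipTwo j), a * X j, b * X j, ?_⟩
      simp only [map_mul, rename_X]
      linear_combination X (skipTwo j) * h
    fin_cases i
    · exact key 0
    · exact key 1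
    · refine ⟨N + 2, X 1 ^ 2 * q * X 2 + rename skipTwo b,
        -(b * (X 0 ^ 2 * X 2 ^ 2 + 2 * X 0 ^ 2 * X 1 * X 2)),
        X 1 ^ 2 * a + b * (2 * X 0 * X 1 * X 2 - 2 * X 0 * X 1 ^ 2), ?_⟩
      simp only [map_add, map_sub, map_neg, map_mul, map_pow, map_ofNat, rename_X,
        show skipTwo 0 = 0 from rfl, show skipTwo 1 = 1 from rfl, show skipTwo 2 = 3 from rfl]
      change X 1 ^ (N + 2) * (p * X 2) = _
      rw [Kpoly] at h ⊢
      linear_combination X 1 ^ 2 * X 2 * h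
    · exact key 2

/-- A polynomial vanishing on the twistor fibres over the parabola vanishes on the
complexification of that family of lines. -/
theorem eval_eq_zero_of_real_parameter (p : MvPolynomial (Fin 4) ℂ) (Z₀ Z₁ : ℂ)
    (hp : ∀ x : ℝ, eval ![Z₀, Z₁, ((x : ℂ) ^ 2 + Complex.I * (x : ℂ)) * Z₀,
        ((x : ℂ) ^ 2 - Complex.I * (x : ℂ)) * Z₁] p = 0) (x : ℂ) :
    eval ![Z₀, Z₁, (x ^ 2 + Complex.I * x) * Z₀, (x ^ 2 - Complex.I * x) * Z₁] p = 0 := by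
  let P : Polynomial ℂ := aeval ![Polynomial.C Z₀, Polynomial.C Z₁,
    (Polynomial.X ^ 2 + Polynomial.C Complex.I * Polynomial.X) * Polynomial.C Z₀,
    (Polynomial.X ^ 2 - Polynomial.C Complex.I * Polynomial.X) * Polynomial.C Z₁] p
  have hP (t : ℂ) : P.eval t =
      eval ![Z₀, Z₁, (t ^ 2 + Complex.I * t) * Z₀, (t ^ 2 - Complex.I * t) * Z₁] p := by
    rw [← Polynomial.coe_aeval_eq_eval, ← coe_aeval_eq_eval]
    change ((Polynomial.aeval t).comp (aeval _)) p = aeval _ p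
    congr 1
    ext i
    fin_cases i <;> simp
  have hzero : P = 0 := Polynomial.eq_zero_of_infinite_isRoot P <|
    (Set.infinite_range_of_injective Complex.ofReal_injective).mono <| by
      rintro _ ⟨r, rfl⟩
      exact (hP r).trans (hp r)
  rw [← hP, hzero, Polynomial.eval_zero]

/-- No nonzero polynomial of degree at most one in `Z₂`, with coefficients in `ℂ[Z₀, Z₁, Z₃]`,
vanishes on the lines over the complexified parabola. -/
theorem eq_zero_of_linear_vanishing (a b : MvPolynomial (Fin 3) ℂ)
    (h : ∀ x Z₀ Z₁ : ℂ, eval ![Z₀, Z₁, (x ^ 2 - Complex.I * x) * Z₁] a +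
      eval ![Z₀, Z₁, (x ^ 2 - Complex.I * x) * Z₁] b * ((x ^ 2 + Complex.I * x) * Z₀) = 0) :
    a = 0 ∧ b = 0 := by
  have I2 := Complex.I_sq
  have param (w Z₁ : ℂ) (hZ₁ : Z₁ ≠ 0) : ∃ x : ℂ, (x ^ 2 - Complex.I * x) * Z₁ = w := by
    obtain ⟨s, hs⟩ := IsAlgClosed.exists_pow_nat_eq (w / Z₁ - 1 / 4) two_pos
    refine ⟨s + Complex.I / 2, ?_⟩
    rw [show (s + Complex.I / 2) ^ 2 - Complex.I * (s + Complex.I / 2) = w / Z₁ by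
      linear_combination hs - I2 / 4]
    exact div_mul_cancel₀ w hZ₁
  have hb : b = 0 := by
    have hprod : b * (X 0 * X 1 * (X 1 - 4 * X 2)) = 0 := by
      refine MvPolynomial.funext fun f => ?_
      have hf : f = ![f 0, f 1, f 2] := by ext i; fin_cases i <;> rfl
      rw [hf]
      generalize f 0 = Z₀, f 1 = Z₁, f 2 = w
      simp only [map_mul, map_sub, map_ofNat, eval_X, map_zero, Matrix.cons_val]
      rcases eq_or_ne Z₁ 0 with rfl | hZ₁
      · simp
      obtain ⟨x, rfl⟩ := param w Z₁ hZ₁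
      -- `x` and `I - x` give the same `Z₃`
      have h₁ := h x Z₀ Z₁
      have h₂ := h (Complex.I - x) Z₀ Z₁
      rw [show (Complex.I - x) ^ 2 - Complex.I * (Complex.I - x) = x ^ 2 - Complex.I * x by ring]
        at h₂
      generalize eval _ a = A, eval _ b = B at h₁ h₂ ⊢
      have h₃ : B * Z₀ * (2 + 4 * Complex.I * x) = 0 := by
        linear_combination h₁ - h₂ + 2 * B * Z₀ * I2
      linear_combination Z₁ ^ 2 / 4 * (2 + 4 * Complex.I * x) * h₃ -
        4 * B * Z₀ * Z₁ ^ 2 * x ^ 2 * I2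
    refine (mul_eq_zero.mp hprod).resolve_right fun h0 => ?_
    simpa using congrArg (eval ![1, 1, 0]) h0
  refine ⟨?_, hb⟩
  subst hb
  have hprod : a * X 1 = 0 := by
    refine MvPolynomial.funext fun f => ?_
    have hf : f = ![f 0, f 1, f 2] := by ext i; fin_cases i <;> rfl
    rw [hf]
    generalize f 0 = Z₀, f 1 = Z₁, f 2 = w
    rcases eq_or_ne Z₁ 0 with rfl | hZ₁
    · simp
    obtain ⟨x, rfl⟩ := param w Z₁ hZ₁
    have h₁ := h x Z₀ Z₁
    rw [map_zero, zero_mul, add_zero] at h₁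
    rw [map_mul, h₁, zero_mul, map_zero]
  exact (mul_eq_zero.mp hprod).resolve_right (X_ne_zero 1)

/-- If a polynomial `p ∈ ℂ[Z₀,Z₁,Z₂,Z₃]` vanishes on the affine cone
`{(Z₀, Z₁, (x²+ix)Z₀, (x²-ix)Z₁)}` over the twistor fibre of every point `x²+ix` of the
parabola (`x ∈ ℝ`), then `p` is divisible by the quartic `K`. -/
theorem statement17 (p : MvPolynomial (Fin 4) ℂ)
    (hp : ∀ x : ℝ, ∀ Z₀ Z₁ : ℂ,
      eval ![Z₀, Z₁, ((x : ℂ) ^ 2 + Complex.I * (x : ℂ)) * Z₀,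
        ((x : ℂ) ^ 2 - Complex.I * (x : ℂ)) * Z₁] p = 0) :
    Kpoly ∣ p := by
  obtain ⟨N, q, a, b, h⟩ := exists_pseudo_division_Kpoly p
  have hab : a = 0 ∧ b = 0 := by
    refine eq_zero_of_linear_vanishing a b fun x Z₀ Z₁ => ?_
    have hx := congrArg
      (eval ![Z₀, Z₁, (x ^ 2 + Complex.I * x) * Z₀, (x ^ 2 - Complex.I * x) * Z₁]) h
    have hcomp : ![Z₀, Z₁, (x ^ 2 + Complex.I * x) * Z₀, (x ^ 2 - Complex.I * x) * Z₁] ∘ skipTwo =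
        ![Z₀, Z₁, (x ^ 2 - Complex.I * x) * Z₁] := by
      ext i; fin_cases i <;> rfl
    have hK : eval ![Z₀, Z₁, (x ^ 2 + Complex.I * x) * Z₀, (x ^ 2 - Complex.I * x) * Z₁]
        Kpoly = 0 := by
      simp only [Kpoly, map_add, map_sub, map_mul, map_pow, map_ofNat, eval_X, Matrix.cons_val]
      linear_combination 4 * x ^ 2 * Z₀ ^ 2 * Z₁ ^ 2 * Complex.I_sq
    simp only [map_add, map_mul, hK, eval_rename, hcomp, eval_X, Matrix.cons_val,
      eval_eq_zero_of_real_parameter p Z₀ Z₁ (fun r => hp r Z₀ Z₁) x] at hx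
    linear_combination -hx
  obtain ⟨rfl, rfl⟩ := hab
  simp only [map_zero, zero_mul, add_zero] at h
  have hndvd : ¬ (X 1 : MvPolynomial (Fin 4) ℂ) ∣ Kpoly := by
    rintro ⟨r, hr⟩
    simpa [Kpoly] using congrArg (eval ![1, 0, 0, 1]) hr
  obtain ⟨r, rfl⟩ :=
    (X_prime (R := ℂ) (i := (1 : Fin 4))).pow_dvd_of_dvd_mul_left N hndvd ⟨p, h.symm⟩
  refine ⟨r, mul_left_cancel₀ (pow_ne_zero N (X_ne_zero (1 : Fin 4))) ?_⟩
  linear_combination h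
end

section
/- Let K(Z₀,Z₁,Z₂,Z₃) = (Z₁Z₂ − Z₀Z₃)² + 2Z₀Z₁(Z₁Z₂ + Z₀Z₃), and let w₁, w₂ ∈ ℂ. Then K(Z₀, Z₁, w₁Z₀ − conj(w₂)Z₁, w₂Z₀ + conj(w₁)Z₁) = 0 for all Z₀, Z₁ ∈ ℂ if and only if w₂ = 0 and there exists t ∈ ℝ with w₁ = t² + it. That is, the twistor fibre over a point q̃ = w₁ + w₂j ∈ ℍ is entirely contained in the quartic surface 𝒦 = {K = 0} exactly when q̃ lies on the parabola γ = {t²+ti : t ∈ ℝ}. -/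
/-- The quartic polynomial `K(Z₀,Z₁,Z₂,Z₃) = (Z₁Z₂ - Z₀Z₃)² + 2Z₀Z₁(Z₁Z₂ + Z₀Z₃)`. -/
def quarticK (Z₀ Z₁ Z₂ Z₃ : ℂ) : ℂ :=
  (Z₁ * Z₂ - Z₀ * Z₃) ^ 2 + 2 * Z₀ * Z₁ * (Z₁ * Z₂ + Z₀ * Z₃)

/-- The twistor fibre over `q̃ = w₁ + w₂ j`, with affine cone
`{(Z₀, Z₁, w₁Z₀ - conj(w₂)Z₁, w₂Z₀ + conj(w₁)Z₁)}`, is contained in the quartic surface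
`𝒦 = {K = 0}` if and only if `w₂ = 0` and `w₁ = t² + it` for some `t ∈ ℝ`, i.e. iff
`q̃` lies on the parabola `γ`. -/
theorem statement18 (w₁ w₂ : ℂ) :
    (∀ Z₀ Z₁ : ℂ,
      quarticK Z₀ Z₁ (w₁ * Z₀ - (starRingEnd ℂ) w₂ * Z₁)
        (w₂ * Z₀ + (starRingEnd ℂ) w₁ * Z₁) = 0) ↔
    (w₂ = 0 ∧ ∃ t : ℝ, w₁ = (t : ℂ) ^ 2 + (t : ℂ) * Complex.I) := by
  constructor
  · intro h
    have hw₂ : w₂ = 0 := by simpa [quarticK] using h 1 0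
    subst hw₂
    refine ⟨rfl, w₁.im, ?_⟩
    have hre : w₁.re = w₁.im ^ 2 := by
      have h₁ := congrArg Complex.re (h 1 1)
      simp [quarticK, pow_two] at h₁
      linarith
    apply Complex.ext <;> simp [pow_two, hre]
  · rintro ⟨rfl, t, rfl⟩ Z₀ Z₁
    simp only [quarticK, map_add, map_mul, map_pow, map_zero, Complex.conj_ofReal, Complex.conj_I]
    linear_combination 4 * (t : ℂ) ^ 2 * Z₀ ^ 2 * Z₁ ^ 2 * Complex.I_sq
end
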